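/- The function g⁻ is lower semicontinuous on H⁺(y₀)×X. -/

import Mathlib

open Filter Topology Set
open scoped NNReal ENNReal

noncomputable section

/-- A partial semiflow on a topological space `Z`. The value `none` plays the role of the
symbol `◊` ("undefined").  Time is modelled by `ℝ≥0`. -/
structure PartialSemiflow (Z : Type*) [TopologicalSpace Z] where
  /-- The (partially defined) flow map. -/
  flow : ℝ≥0 → Z → Option Z
  /-- The domain of definition is open in `[0,∞) × Z`. -/
  isOpen_dom : IsOpen {p : ℝ≥0 × Z | (flow p.1 p.2).isSome = true}
  /-- The flow is continuous on its domain of definition. -/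
  continuous_flow : ∀ V : Set Z, IsOpen V →
    IsOpen {p : ℝ≥0 × Z | ∃ z ∈ V, flow p.1 p.2 = some z}
  /-- `z π 0 = z`. -/
  flow_zero : ∀ z, flow 0 z = some z
  /-- The semigroup property; `◊ π t = ◊` is built into `Option.bind`. -/
  flow_add : ∀ (t₁ t₂ : ℝ≥0) (z : Z), flow (t₁ + t₂) z = (flow t₁ z).bind (flow t₂)

namespace PartialSemiflow

variable {Z : Type*} [TopologicalSpace Z] (π : PartialSemiflow Z)

/-- `π.mem t z M` means: `z π t` is defined and belongs to `M`. -/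
def mem (t : ℝ≥0) (z : Z) (M : Set Z) : Prop := ∃ w ∈ M, π.flow t z = some w

/-- `π.segMem t z M` means `z π [0,t] ⊆ M`. -/
def segMem (t : ℝ≥0) (z : Z) (M : Set Z) : Prop := ∀ s ≤ t, π.mem s z M

/-- A full solution `u : ℝ → Z` of the semiflow. -/
def IsSolution (u : ℝ → Z) : Prop :=
  ∀ (t₀ : ℝ) (s : ℝ≥0), π.flow s (u t₀) = some (u (t₀ + (s : ℝ)))

/-- The largest invariant subset of `N`. -/
def Inv (N : Set Z) : Set Z :=
  {z | ∃ u : ℝ → Z, π.IsSolution u ∧ (∀ t, u t ∈ N) ∧ u 0 = z}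

/-- The largest negatively invariant subset of `N` (solutions on `(-∞,0]`). -/
def InvMinus (N : Set Z) : Set Z :=
  {z | ∃ u : ℝ → Z, (∀ t ≤ (0 : ℝ), u t ∈ N) ∧
    (∀ (t₀ : ℝ) (s : ℝ≥0), t₀ + (s : ℝ) ≤ 0 → π.flow s (u t₀) = some (u (t₀ + (s : ℝ)))) ∧
    u 0 = z}

/-- Strong admissibility of a set `M`: asymptotic compactness together with
non-explosion of the semiflow in `M`. -/
def StronglyAdmissible (M : Set Z) : Prop :=
  (∀ (z : ℕ → Z) (t : ℕ → ℝ≥0),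
      (∀ n, π.segMem (t n) (z n) M) →
      ∃ w : ℕ → Z, (∀ n, π.flow (t n) (z n) = some (w n)) ∧
        ∃ φ : ℕ → ℕ, StrictMono φ ∧ ∃ l : Z, Tendsto (w ∘ φ) atTop (nhds l)) ∧
  (∀ (z : Z) (t : ℝ≥0), (∀ s < t, ∃ w ∈ M, π.flow s z = some w) → (π.flow t z).isSome)

end PartialSemiflow

/-- A global (everywhere defined) semiflow on `Y`, the "translation" `y ↦ y^t`. -/
structure GlobalSemiflow (Y : Type*) [TopologicalSpace Y] where
  /-- The translation map. -/
  trans : ℝ≥0 → Y → Y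
  continuous_trans : Continuous fun p : ℝ≥0 × Y => trans p.1 p.2
  trans_zero : ∀ y, trans 0 y = y
  trans_add : ∀ (s t : ℝ≥0) (y : Y), trans (s + t) y = trans t (trans s y)

variable {X Y : Type*} [MetricSpace X] [MetricSpace Y]

/-- `π` is a skew-product semiflow over the translation semiflow `σ`:  whenever
`(y,x) π t` is defined, its first component is `y^t`. -/
def GlobalSemiflow.IsSkewProduct (σ : GlobalSemiflow Y) (π : PartialSemiflow (Y × X)) : Prop :=
  ∀ (t : ℝ≥0) (y : Y) (x : X) (w : Y × X), π.flow t (y, x) = some w → w.1 = σ.trans t y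

/-- The positive hull `H⁺(y₀)` of `y₀`. -/
def hullPlus (σ : GlobalSemiflow Y) (y₀ : Y) : Set Y :=
  closure {y | ∃ t : ℝ≥0, σ.trans t y₀ = y}

/-- The space `H⁺(y₀) × X`, as a subset of `Y × X`. -/
def extSpace (σ : GlobalSemiflow Y) (y₀ : Y) : Set (Y × X) :=
  (hullPlus σ y₀) ×ˢ (Set.univ : Set X)

/-- The map `r = r_{y₀} : [0,∞) × X → H⁺(y₀) × X`, `r(t,x) = (y₀^t, x)`. -/
def rMap (σ : GlobalSemiflow Y) (y₀ : Y) : ℝ≥0 × X → Y × X :=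
  fun p => (σ.trans p.1 y₀, p.2)

/-- The canonical semiflow `χ = χ_{y₀}` on `[0,∞) × X`:
`(t,x) χ s = (t+s, Φ(s, y₀^t, x))`. -/
def chi (σ : GlobalSemiflow Y) (π : PartialSemiflow (Y × X)) (y₀ : Y)
    (s : ℝ≥0) (p : ℝ≥0 × X) : Option (ℝ≥0 × X) :=
  (π.flow s (σ.trans p.1 y₀, p.2)).map fun w => (p.1 + s, w.2)

/-- `chiMem σ π y₀ s p M` means: `p χ s` is defined and belongs to `M`. -/
def chiMem (σ : GlobalSemiflow Y) (π : PartialSemiflow (Y × X)) (y₀ : Y)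
    (s : ℝ≥0) (p : ℝ≥0 × X) (M : Set (ℝ≥0 × X)) : Prop :=
  ∃ q ∈ M, chi σ π y₀ s p = some q

/-- `N` is an isolating neighborhood for `K` in `H⁺(y₀) × X`. -/
def IsIsolatingNbhd (σ : GlobalSemiflow Y) (π : PartialSemiflow (Y × X)) (y₀ : Y)
    (K N : Set (Y × X)) : Prop :=
  N ⊆ extSpace σ y₀ ∧ IsClosed N ∧
  (∀ z ∈ π.Inv N, N ∈ nhdsWithin z (extSpace σ y₀)) ∧ K = π.Inv N

/-- `W` is a neighborhood of `K` in `H⁺(y₀) × X`. -/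
def IsNbhdOfIn (σ : GlobalSemiflow Y) (y₀ : Y) (K W : Set (Y × X)) : Prop :=
  W ⊆ extSpace σ y₀ ∧ ∀ z ∈ K, W ∈ nhdsWithin z (extSpace (X := X) σ y₀)

/-- A basic index pair in `[0,∞) × X` relative to the semiflow `χ_{y₀}`. -/
structure IsBasicIndexPair (σ : GlobalSemiflow Y) (π : PartialSemiflow (Y × X)) (y₀ : Y)
    (N₁ N₂ : Set (ℝ≥0 × X)) : Prop where
  subset : N₂ ⊆ N₁
  closed₁ : IsClosed N₁
  closed₂ : IsClosed N₂
  ip2 : ∀ p ∈ N₁, ∀ t : ℝ≥0, ¬ chiMem σ π y₀ t p N₁ → ∃ s ≤ t, chiMem σ π y₀ s p N₂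
  ip3 : ∀ p ∈ N₂, ∀ t : ℝ≥0, ¬ chiMem σ π y₀ t p N₂ → ∃ s ≤ t, ¬ chiMem σ π y₀ s p N₁

/-- An index pair for `(y₀, K)`. -/
structure IsIndexPair (σ : GlobalSemiflow Y) (π : PartialSemiflow (Y × X)) (y₀ : Y)
    (K : Set (Y × X)) (N₁ N₂ : Set (ℝ≥0 × X)) : Prop where
  toBasic : IsBasicIndexPair σ π y₀ N₁ N₂
  ip4 : ∃ N : Set (Y × X), IsIsolatingNbhd σ π y₀ K N ∧ π.StronglyAdmissible N ∧
    N₁ \ N₂ ⊆ rMap σ y₀ ⁻¹' N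
  ip5 : ∃ W : Set (Y × X), IsNbhdOfIn σ y₀ K W ∧ rMap σ y₀ ⁻¹' W ⊆ N₁ \ N₂

/-- `N₂^{-T}(N₁) = {p ∈ N₁ : p χ s ∈ N₂ for some s ∈ [0,T]}`. -/
def backSet (σ : GlobalSemiflow Y) (π : PartialSemiflow (Y × X)) (y₀ : Y)
    (N₁ N₂ : Set (ℝ≥0 × X)) (T : ℝ≥0) : Set (ℝ≥0 × X) :=
  {p ∈ N₁ | ∃ s ≤ T, chiMem σ π y₀ s p N₂}


/-- The relation identifying all points of `A ∩ B`, together with an extra point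
(which serves as the class `[B]` even when `A ∩ B = ∅`). -/
def quotRel {Z : Type*} (A B : Set Z) : ↥A ⊕ Unit → ↥A ⊕ Unit → Prop
  | Sum.inl a, Sum.inl b => a = b ∨ ((a : Z) ∈ B ∧ (b : Z) ∈ B)
  | Sum.inl a, Sum.inr _ => (a : Z) ∈ B
  | Sum.inr _, Sum.inl b => (b : Z) ∈ B
  | Sum.inr _, Sum.inr _ => True

/-- The pointed quotient space `A/B`. -/
def PtdQuot {Z : Type*} [TopologicalSpace Z] (A B : Set Z) : Type _ := Quot (quotRel A B)

instance {Z : Type*} [TopologicalSpace Z] (A B : Set Z) : TopologicalSpace (PtdQuot A B) :=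
  inferInstanceAs (TopologicalSpace (Quot _))

/-- The base point `[B]` of `A/B`. -/
def PtdQuot.pt {Z : Type*} [TopologicalSpace Z] (A B : Set Z) : PtdQuot A B :=
  Quot.mk _ (Sum.inr ())

/-- `f : (Z, z₀) → (W, w₀)` is a pointed homotopy equivalence. -/
def IsPointedHomotopyEquiv {Z W : Type*} [TopologicalSpace Z] [TopologicalSpace W]
    (z₀ : Z) (w₀ : W) (f : C(Z, W)) : Prop :=
  f z₀ = w₀ ∧ ∃ g : C(W, Z), g w₀ = z₀ ∧
    Nonempty (ContinuousMap.HomotopyRel (g.comp f) (ContinuousMap.id Z) {z₀}) ∧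
    Nonempty (ContinuousMap.HomotopyRel (f.comp g) (ContinuousMap.id W) {w₀})

/-- There is a pointed homotopy equivalence `(Z,z₀) → (W,w₀)`. -/
def PointedHomotopyEquivalent {Z W : Type*} [TopologicalSpace Z] [TopologicalSpace W]
    (z₀ : Z) (w₀ : W) : Prop :=
  ∃ f : C(Z, W), IsPointedHomotopyEquiv z₀ w₀ f

variable {X Y : Type*} [MetricSpace X] [MetricSpace Y]

/-- `g⁺(z) = sup{t ≥ 0 : z π [0,t] ⊆ U}`, with `sup ∅ = 0`, valued in `[0,∞]`. -/
def gPlus (π : PartialSemiflow (Y × X)) (U : Set (Y × X)) (z : Y × X) : ℝ≥0∞ :=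
  ⨆ t ∈ {t : ℝ≥0 | π.segMem t z U}, (t : ℝ≥0∞)

/-- `g⁻(z) = sup{d(z π t, Inv⁻(N)) : t ∈ [0, g⁺(z)], z π t ≠ ◊}`, with `sup ∅ = 0`
and `d(·,∅) = ∞`, valued in `[0,∞]`. -/
def gMinus (π : PartialSemiflow (Y × X)) (U N : Set (Y × X)) (z : Y × X) : ℝ≥0∞ :=
  ⨆ t ∈ {t : ℝ≥0 | (t : ℝ≥0∞) ≤ gPlus π U z},
    ⨆ w ∈ {w : Y × X | π.flow t z = some w}, EMetric.infEdist w (π.InvMinus N)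

/-- The function `f(p) = sup{t₀ ≥ 0 : p χ s ∈ cl(N₁ \ N₂) for all s ∈ [0,t₀]}`,
with `sup ∅ = 0`, valued in `[0,∞]`. -/
def fTime (σ : GlobalSemiflow Y) (π : PartialSemiflow (Y × X)) (y₀ : Y)
    (N₁ N₂ : Set (ℝ≥0 × X)) (p : ℝ≥0 × X) : ℝ≥0∞ :=
  ⨆ t₀ ∈ {t₀ : ℝ≥0 | ∀ s ≤ t₀, chiMem σ π y₀ s p (closure (N₁ \ N₂))}, (t₀ : ℝ≥0∞)

/-- The α-limit set of a full solution `u`. -/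
def solAlphaLimit (u : ℝ → Y × X) : Set (Y × X) := ⋂ t : ℝ, closure (u '' Set.Iic t)

/-- The ω-limit set of a full solution `u`. -/
def solOmegaLimit (u : ℝ → Y × X) : Set (Y × X) := ⋂ t : ℝ, closure (u '' Set.Ici t)

/-- `(A, R)` is an attractor-repeller decomposition of the isolated invariant set `K`. -/
structure IsARDecomp (σ : GlobalSemiflow Y) (π : PartialSemiflow (Y × X)) (y₀ : Y)
    (K A R : Set (Y × X)) : Prop where
  A_subset : A ⊆ K
  R_subset : R ⊆ K
  disjoint : Disjoint A R
  A_isolated : ∃ N, IsIsolatingNbhd σ π y₀ A N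
  R_isolated : ∃ N, IsIsolatingNbhd σ π y₀ R N
  alternatives : ∀ u : ℝ → Y × X, π.IsSolution u → (∀ t, u t ∈ K) →
    (∀ t, u t ∈ A) ∨ (∀ t, u t ∈ R) ∨ (solAlphaLimit u ⊆ R ∧ solOmegaLimit u ⊆ A)

/-- An index triple for `(y₀, K, A, R)`. -/
structure IsIndexTriple (σ : GlobalSemiflow Y) (π : PartialSemiflow (Y × X)) (y₀ : Y)
    (K A R : Set (Y × X)) (N₁ N₂ N₃ : Set (ℝ≥0 × X)) : Prop where
  sub32 : N₃ ⊆ N₂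
  sub21 : N₂ ⊆ N₁
  pairK : IsIndexPair σ π y₀ K N₁ N₃
  pairA : IsIndexPair σ π y₀ A N₂ N₃

/-- An FM-index pair for `K` relative to `π`, restricted to `H⁺(y₀) × X`. -/
structure IsFMIndexPair (σ : GlobalSemiflow Y) (π : PartialSemiflow (Y × X)) (y₀ : Y)
    (K N₁ N₂ : Set (Y × X)) : Prop where
  subset : N₂ ⊆ N₁
  sub_ext : N₁ ⊆ extSpace σ y₀
  closed₁ : IsClosed N₁
  closed₂ : IsClosed N₂
  isolating : IsIsolatingNbhd σ π y₀ K (closure (N₁ \ N₂))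
  interior_K : ∀ z ∈ K, N₁ \ N₂ ∈ nhdsWithin z (extSpace σ y₀)
  posInv : ∀ z ∈ N₂, ∀ t : ℝ≥0, (∀ s ≤ t, π.mem s z N₁) → ∀ s ≤ t, π.mem s z N₂
  exit : ∀ z ∈ N₁, ∀ t : ℝ≥0, ¬ π.mem t z N₁ →
    ∃ s ≤ t, (∀ s' ≤ s, π.mem s' z N₁) ∧ π.mem s z N₂


namespace PartialSemiflow

variable {Z : Type*} [TopologicalSpace Z] {π : PartialSemiflow Z}

theorem segMem.mono_time {s t : ℝ≥0} {z : Z} {M : Set Z} (h : π.segMem t z M) (hst : s ≤ t) :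
    π.segMem s z M :=
  fun r hr => h r (hr.trans hst)

/-- The points that are mapped into an open set by the time-`t` map form an open set. -/
theorem isOpen_setOf_mem (t : ℝ≥0) {O : Set Z} (hO : IsOpen O) : IsOpen {z | π.mem t z O} :=
  (π.continuous_flow O hO).preimage (Continuous.prodMk_right t)

/-- The times at which a given orbit lies in an open set form an open set. -/
theorem isOpen_setOf_time_mem (z : Z) {O : Set Z} (hO : IsOpen O) :
    IsOpen {t | π.mem t z O} :=
  (π.continuous_flow O hO).preimage (Continuous.prodMk_left z)

/-- An orbit segment contained in an open set stays in it under perturbation of the initial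
point. -/
theorem segMem.eventually {t : ℝ≥0} {z : Z} {V : Set Z} (hV : IsOpen V) (h : π.segMem t z V) :
    ∀ᶠ z' in 𝓝 z, π.segMem t z' V := by
  have key : ∀ᶠ z' in 𝓝 z, ∀ s ∈ Icc 0 t, π.mem s z' V := by
    refine isCompact_Icc.eventually_forall_of_forall_eventually fun s hs => ?_
    have hopen : IsOpen {p : Z × ℝ≥0 | π.mem p.2 p.1 V} :=
      (π.continuous_flow V hV).preimage continuous_swap
    exact hopen.mem_nhds (h s hs.2)
  exact key.mono fun z' hz' s hs => hz' s ⟨zero_le, hs⟩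

end PartialSemiflow

/-- The positive hull is positively invariant. -/
theorem GlobalSemiflow.trans_mem_hullPlus (σ : GlobalSemiflow Y) (y₀ : Y) (t : ℝ≥0) {y : Y}
    (hy : y ∈ hullPlus σ y₀) : σ.trans t y ∈ hullPlus σ y₀ := by
  have hcont : Continuous (σ.trans t) := σ.continuous_trans.comp (Continuous.prodMk_right t)
  refine map_mem_closure hcont hy ?_
  rintro _ ⟨s, rfl⟩
  exact ⟨s + t, σ.trans_add s t y₀⟩

/-- `H⁺(y₀) × X` is positively invariant under a skew-product semiflow. -/
theorem GlobalSemiflow.IsSkewProduct.mem_extSpace {σ : GlobalSemiflow Y}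
    {π : PartialSemiflow (Y × X)} (h : σ.IsSkewProduct π) {y₀ : Y} {t : ℝ≥0} {z w : Y × X}
    (hz : z ∈ extSpace (X := X) σ y₀) (hw : π.flow t z = some w) :
    w ∈ extSpace (X := X) σ y₀ := by
  refine ⟨?_, mem_univ _⟩
  rw [h t z.1 z.2 w hw]
  exact σ.trans_mem_hullPlus y₀ t hz.1

theorem PartialSemiflow.segMem.le_gPlus {π : PartialSemiflow (Y × X)} {U : Set (Y × X)}
    {t : ℝ≥0} {z : Y × X} (h : π.segMem t z U) : (t : ℝ≥0∞) ≤ gPlus π U z :=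
  le_iSup₂ (f := fun (t : ℝ≥0) (_ : t ∈ {t : ℝ≥0 | π.segMem t z U}) => (t : ℝ≥0∞)) t h

theorem segMem_of_lt_gPlus {π : PartialSemiflow (Y × X)} {U : Set (Y × X)}
    {t : ℝ≥0} {z : Y × X} (h : (t : ℝ≥0∞) < gPlus π U z) : π.segMem t z U := by
  simp only [gPlus, lt_iSup_iff] at h
  obtain ⟨s, hs, hts⟩ := h
  exact PartialSemiflow.segMem.mono_time hs (ENNReal.coe_lt_coe.1 hts).le

/-- The supremum defining `g⁻(z)` exceeds `c` iff the distance does so at some admissible time. -/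
theorem lt_gMinus_iff {π : PartialSemiflow (Y × X)} {U N : Set (Y × X)} {z : Y × X} {c : ℝ≥0∞} :
    c < gMinus π U N z ↔ ∃ t : ℝ≥0, (t : ℝ≥0∞) ≤ gPlus π U z ∧
      π.mem t z {w | c < Metric.infEDist w (π.InvMinus N)} := by
  simp only [gMinus, lt_iSup_iff, PartialSemiflow.mem, mem_ofPred_eq, exists_prop]
  exact exists_congr fun t => and_congr_right fun _ => exists_congr fun w => and_comm

/-- Besides `t = 0`, only times at which the whole orbit segment lies in `U` matter for `g⁻`. -/
theorem exists_time_of_lt_gMinus {π : PartialSemiflow (Y × X)} {U N : Set (Y × X)} {z : Y × X}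
    {c : ℝ≥0∞} (h : c < gMinus π U N z) :
    ∃ t : ℝ≥0, (t = 0 ∨ π.segMem t z U) ∧
      π.mem t z {w | c < Metric.infEDist w (π.InvMinus N)} := by
  obtain ⟨t, ht, hmem⟩ := lt_gMinus_iff.1 h
  rcases eq_or_ne t 0 with rfl | ht0
  · exact ⟨0, Or.inl rfl, hmem⟩
  have hO : IsOpen {w : Y × X | c < Metric.infEDist w (π.InvMinus N)} :=
    isOpen_lt continuous_const Metric.continuous_infEDist
  obtain ⟨s, hst, hs⟩ := exists_Ioc_subset_of_mem_nhds
    ((π.isOpen_setOf_time_mem z hO).mem_nhds hmem) ⟨0, pos_iff_ne_zero.2 ht0⟩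
  obtain ⟨r, hsr, hrt⟩ := exists_between hst
  exact ⟨r, Or.inr (segMem_of_lt_gPlus ((ENNReal.coe_lt_coe.2 hrt).trans_le ht)),
    hs ⟨hsr, hrt.le⟩⟩

theorem statement_6 (σ : GlobalSemiflow Y) (π : PartialSemiflow (Y × X)) (hσπ : σ.IsSkewProduct π) (y₀ : Y)
    (K N U : Set (Y × X))
    (hNiso : IsIsolatingNbhd σ π y₀ K N) (hNadm : π.StronglyAdmissible N)
    (hUopen : ∃ V : Set (Y × X), IsOpen V ∧ U = V ∩ extSpace σ y₀)
    (hKU : K ⊆ U) (hUN : U ⊆ N) :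
    LowerSemicontinuousOn (gMinus π U N) (extSpace σ y₀) := by
  obtain ⟨V, hV, rfl⟩ := hUopen
  intro z hz c hc
  obtain ⟨t, ht, hmem⟩ := exists_time_of_lt_gMinus hc
  have hO : IsOpen {w : Y × X | c < Metric.infEDist w (π.InvMinus N)} :=
    isOpen_lt continuous_const Metric.continuous_infEDist
  have hmem' : ∀ᶠ z' in 𝓝[extSpace σ y₀] z,
      π.mem t z' {w | c < Metric.infEDist w (π.InvMinus N)} :=
    mem_nhdsWithin_of_mem_nhds ((π.isOpen_setOf_mem t hO).mem_nhds hmem)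
  have htime : ∀ᶠ z' in 𝓝[extSpace σ y₀] z,
      (t : ℝ≥0∞) ≤ gPlus π (V ∩ extSpace σ y₀) z' := by
    rcases ht with rfl | ht
    · exact Eventually.of_forall fun _ => by simp
    have htV : π.segMem t z V := fun s hs =>
      (ht s hs).imp fun _ hw => ⟨hw.1.1, hw.2⟩
    filter_upwards [mem_nhdsWithin_of_mem_nhds (htV.eventually hV), self_mem_nhdsWithin]
      with z' hz'V hz'
    refine PartialSemiflow.segMem.le_gPlus fun s hs => ?_
    obtain ⟨w, hwV, hw⟩ := hz'V s hs
    exact ⟨w, ⟨hwV, hσπ.mem_extSpace hz' hw⟩, hw⟩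
  filter_upwards [hmem', htime] with z' h₁ h₂
  exact lt_gMinus_iff.2 ⟨t, h₂, h₁⟩

end
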